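/- arXiv:1804.09240 — 6 statements merged into one kernel-verified Lean document; each statement's English description precedes it below -/
import Mathlib

section
/- For all positive integers ℓ, n, all m ≥ 3, and all connected graphs G_1, …, G_m on n vertices each, the generalized wheel W(G_1, …, G_m, n, ℓ, m) is in host(K_{ℓ+2}). -/
open SimpleGraph

section Defs

variable {V : Type*} {W : Type*}

/-- `f` is an `H`-model of `G`: every branch set (preimage of a label) is nonempty and
connected, and for every edge of `H` there is a connecting edge of `G`. -/
def IsModel (G : SimpleGraph V) (H : SimpleGraph W) (f : V → W) : Prop :=
  (∀ i : W, (f ⁻¹' {i}).Nonempty ∧ (G.induce (f ⁻¹' {i})).Connected) ∧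
  ∀ ⦃i j : W⦄, H.Adj i j → ∃ u v : V, G.Adj u v ∧ f u = i ∧ f v = j

/-- One reconfiguration step: both endpoints are `H`-models and they differ on exactly
one vertex of `G`. -/
def ModelStep (G : SimpleGraph V) (H : SimpleGraph W) (f g : V → W) : Prop :=
  IsModel G H f ∧ IsModel G H g ∧ ∃ v : V, f v ≠ g v ∧ ∀ u : V, u ≠ v → f u = g u

/-- `G` is in `host(H)`: it admits an `H`-model and the reconfiguration graph of
`H`-models of `G` is connected. -/
def InHost (G : SimpleGraph V) (H : SimpleGraph W) : Prop :=
  (∃ f : V → W, IsModel G H f) ∧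
  ∀ f g : V → W, IsModel G H f → IsModel G H g →
    Relation.ReflTransGen (ModelStep G H) f g

/-- `S` is a cut set of `G`: deleting `S` leaves at least two components. -/
def IsCutSet (G : SimpleGraph V) (S : Set V) : Prop :=
  ∃ u w : ↥(Sᶜ), ¬ (G.induce Sᶜ).Reachable u w

/-- `G` is `k`-connected: it has no cut set of fewer than `k` vertices. -/
def KConnected (G : SimpleGraph V) (k : ℕ) : Prop :=
  ∀ S : Set V, S.Finite → S.ncard < k → ¬ IsCutSet G S

/-- `v` is a cut vertex of the subgraph of `G` induced on `A`. -/
def IsCutVertexOf (G : SimpleGraph V) (A : Set V) (v : V) : Prop :=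
  v ∈ A ∧ ∃ u w : ↥(A \ {v}), ¬ (G.induce (A \ {v})).Reachable u w

def NoCutVertexIn (G : SimpleGraph V) (B : Set V) : Prop :=
  ∀ v : V, ¬ IsCutVertexOf G B v

/-- `B` is a block of the subgraph of `G` induced on `A`: a maximal connected subgraph
of it without a cut vertex. -/
def IsBlockOf (G : SimpleGraph V) (A B : Set V) : Prop :=
  B ⊆ A ∧ B.Nonempty ∧ (G.induce B).Connected ∧ NoCutVertexIn G B ∧
  ∀ B' : Set V, B ⊆ B' → B' ⊆ A → (G.induce B').Connected → NoCutVertexIn G B' → B' = B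

/-- `B` is a leaf block of the subgraph of `G` induced on `A`: a block containing at
most one joining vertex (cut vertex of the induced subgraph on `A`). -/
def IsLeafBlockOf (G : SimpleGraph V) (A B : Set V) : Prop :=
  IsBlockOf G A B ∧
  ∀ v w : V, v ∈ B → w ∈ B → IsCutVertexOf G A v → IsCutVertexOf G A w → v = w

/-- `v` is essential for label `b`: `f v` and `b` are adjacent labels of `H` and every
connecting edge between the branch sets of `f v` and of `b` has `v` as an endpoint. -/
def EssentialFor (G : SimpleGraph V) (H : SimpleGraph W) (f : V → W) (v : V) (b : W) : Prop :=
  H.Adj (f v) b ∧ ∀ u w : V, G.Adj u w → f u = f v → f w = b → u = v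

/-- `v` is crucial: essential for two distinct labels. -/
def IsCrucial (G : SimpleGraph V) (H : SimpleGraph W) (f : V → W) (v : V) : Prop :=
  ∃ b c : W, b ≠ c ∧ EssentialFor G H f v b ∧ EssentialFor G H f v c

/-- `v` is `b`-crucial: `v` has a neighbour labeled `b` and is essential for some label
`c ∉ {f v, b}`. -/
def IsBCrucial (G : SimpleGraph V) (H : SimpleGraph W) (f : V → W) (v : V) (b : W) : Prop :=
  (∃ u : V, G.Adj v u ∧ f u = b) ∧
  ∃ c : W, c ≠ f v ∧ c ≠ b ∧ EssentialFor G H f v c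

/-- `uv` is the unique (essential) connecting edge between branch sets `a` and `b`. -/
def IsEssEdge (G : SimpleGraph V) (f : V → W) (a b : W) (u v : V) : Prop :=
  G.Adj u v ∧ f u = a ∧ f v = b ∧
  ∀ u' v' : V, G.Adj u' v' → f u' = a → f v' = b → u' = u ∧ v' = v

/-- The branch sets of labels `a` and `b` are weakly connected. -/
def WeaklyConnected (G : SimpleGraph V) (H : SimpleGraph W) (f : V → W) (a b : W) : Prop :=
  (∃ v : V, f v = a ∧ EssentialFor G H f v b) ∨
  (∃ v : V, f v = b ∧ EssentialFor G H f v a)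

/-- `p` is a valid designation of a lynchpin for the weak connection between the branch
sets of `a` and `b`: an endpoint of the essential edge if one exists, and otherwise the
essential vertex giving rise to the weak connection. -/
def IsLynchpin (G : SimpleGraph V) (H : SimpleGraph W) (f : V → W) (a b : W) (p : V) : Prop :=
  (∃ u v : V, IsEssEdge G f a b u v ∧ (p = u ∨ p = v)) ∨
  ((∀ u v : V, ¬ IsEssEdge G f a b u v) ∧
    ((f p = a ∧ EssentialFor G H f p b) ∨ (f p = b ∧ EssentialFor G H f p a)))

/-- `C` is a connected component of the subgraph of `G` induced on `A`. -/
def IsCompOf (G : SimpleGraph V) (A C : Set V) : Prop :=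
  C ⊆ A ∧ C.Nonempty ∧ (G.induce C).Connected ∧
  ∀ C' : Set V, C ⊆ C' → C' ⊆ A → (G.induce C').Connected → C' = C

/-- One reconfiguration step that changes (the label of) a vertex of `A` only. -/
def ModelStepWithin (G : SimpleGraph V) (H : SimpleGraph W) (A : Set V) (f g : V → W) : Prop :=
  IsModel G H f ∧ IsModel G H g ∧ ∃ v ∈ A, f v ≠ g v ∧ ∀ u : V, u ≠ v → f u = g u

/-- `g` is reachable from `f` by reconfiguration steps changing only vertices of `A`. -/
def ReachWithin (G : SimpleGraph V) (H : SimpleGraph W) (A : Set V) (f g : V → W) : Prop :=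
  Relation.ReflTransGen (ModelStepWithin G H A) f g

/-- `f` is a leaf-crucial model: some crucial vertex is an interior vertex in a leaf
block of its branch set. -/
def LeafCrucialModel (G : SimpleGraph V) (H : SimpleGraph W) (f : V → W) : Prop :=
  ∃ (v : V) (L : Set V), IsLeafBlockOf G (f ⁻¹' {f v}) L ∧ v ∈ L ∧
    ¬ IsCutVertexOf G (f ⁻¹' {f v}) v ∧ IsCrucial G H f v

/-- `f` is a leaf-`b`-crucial model: some `b`-crucial vertex is an interior vertex in a
leaf block of its branch set. -/
def LeafBCrucialModel (G : SimpleGraph V) (H : SimpleGraph W) (f : V → W) (b : W) : Prop :=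
  ∃ (v : V) (L : Set V), IsLeafBlockOf G (f ⁻¹' {f v}) L ∧ v ∈ L ∧
    ¬ IsCutVertexOf G (f ⁻¹' {f v}) v ∧ IsBCrucial G H f v b

/-- `f` hits a leaf-crucial model on relabeling `A`. -/
def HitsLeafCrucial (G : SimpleGraph V) (H : SimpleGraph W) (A : Set V) (f : V → W) : Prop :=
  ∀ g : V → W, ReachWithin G H A f g →
    ∃ h : V → W, ReachWithin G H A g h ∧ LeafCrucialModel G H h

/-- `f` hits a leaf-`b`-crucial model on relabeling `A`. -/
def HitsLeafBCrucial (G : SimpleGraph V) (H : SimpleGraph W) (A : Set V) (f : V → W)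
    (b : W) : Prop :=
  ∀ g : V → W, ReachWithin G H A f g →
    ∃ h : V → W, ReachWithin G H A g h ∧ LeafBCrucialModel G H h b

end Defs

/-- The generalized wheel `W(G₁, …, G_m, n, ℓ, m)`: `ℓ` pairwise adjacent hub vertices,
`m·n` subgraph vertices `s_{i,j}` with each hub adjacent to every subgraph vertex,
subgraph edges given by the `G_i`, and rim edges `s_{i,j} s_{i+1 mod m, j}`. -/
def genWheel (l m n : ℕ) (Gs : Fin m → SimpleGraph (Fin n)) :
    SimpleGraph (Fin l ⊕ Fin m × Fin n) :=
  SimpleGraph.fromRel (fun p q =>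
    match p, q with
    | .inl _, .inl _ => True
    | .inl _, .inr _ => True
    | .inr _, .inl _ => False
    | .inr (i, j), .inr (i', j') =>
        (i = i' ∧ (Gs i).Adj j j') ∨ (j = j' ∧ (i' : ℕ) = ((i : ℕ) + 1) % m))

section Connectivity

variable {X : Type*} {R : SimpleGraph X}

lemma SimpleGraph.Connected.induce_insert {S : Set X} (hS : (R.induce S).Connected) {u v : X}
    (hu : u ∈ S) (h : R.Adj u v) : (R.induce (insert v S)).Connected := by
  have := induce_union_connected hS.preconnected
    (induce_pair_connected_of_adj h).preconnected ⟨u, hu, by simp⟩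
  convert this using 2 <;> (ext; simp; grind)

lemma SimpleGraph.induce_singleton_connected (x : X) :
    (R.induce ({x} : Set X)).Connected := by
  have : Nonempty ({x} : Set X) := ⟨⟨x, rfl⟩⟩
  exact { preconnected := .of_subsingleton }

lemma SimpleGraph.Connected.exists_adj_of_ssubset {S A : Set X} (hA : (R.induce A).Connected)
    (hSA : S ⊂ A) (hS : S.Nonempty) : ∃ u ∈ S, ∃ v ∈ A, v ∉ S ∧ R.Adj u v := by
  obtain ⟨s, hs⟩ := hS
  obtain ⟨t, htA, ht⟩ := Set.exists_of_ssubset hSA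
  obtain ⟨p⟩ := hA.preconnected ⟨s, hSA.1 hs⟩ ⟨t, htA⟩
  obtain ⟨d, -, h1, h2⟩ := p.exists_boundary_dart {z | z.1 ∈ S} hs ht
  exact ⟨d.fst, h1, d.snd, d.snd.2, h2, d.adj⟩

/-- A property of a connected set `S₀` that survives adding one vertex at a time while staying
connected inside a connected set `A` holds for `A`. -/
lemma SimpleGraph.Connected.grow_induction [Finite X] {S₀ A : Set X} {P : Set X → Prop}
    (hA : (R.induce A).Connected) (hS₀ : (R.induce S₀).Connected) (hsub : S₀ ⊆ A) (h₀ : P S₀)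
    (step : ∀ S v, S₀ ⊆ S → S ⊆ A → (R.induce S).Connected → P S → v ∈ A → v ∉ S →
      (R.induce (insert v S)).Connected → P (insert v S)) : P A := by
  obtain ⟨S, -, hS⟩ := Finite.exists_le_maximal
    (p := fun S => S₀ ⊆ S ∧ S ⊆ A ∧ (R.induce S).Connected ∧ P S) (a := S₀)
    ⟨subset_rfl, hsub, hS₀, h₀⟩
  obtain ⟨h1, h2, h3, h4⟩ := hS.prop
  by_cases h : S = A
  · exact h ▸ h4
  have hne : S.Nonempty := Set.nonempty_coe_sort.1 h3.nonempty
  obtain ⟨u, hu, v, hvA, hvS, huv⟩ := hA.exists_adj_of_ssubset (h2.ssubset_of_ne h) hne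
  have h5 := h3.induce_insert hu huv
  have := hS.le_of_ge ⟨h1.trans (Set.subset_insert v S), Set.insert_subset hvA h2, h5,
    step S v h1 h2 h3 h4 hvA hvS h5⟩ (Set.subset_insert v S)
  exact absurd (this (Set.mem_insert v S)) hvS

lemma SimpleGraph.Connected.exists_induce_diff_singleton_connected [Finite X] {A : Set X}
    (hA : (R.induce A).Connected) {z w : X} (hz : z ∈ A) (hw : w ∈ A) (hwz : w ≠ z) :
    ∃ x ∈ A, x ≠ z ∧ (R.induce (A \ {x})).Connected := by
  have := hA.grow_induction
    (P := fun S => S = {z} ∨ ∃ x ∈ S, x ≠ z ∧ (R.induce (S \ {x})).Connected)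
    (induce_singleton_connected z) (by simpa using hz) (Or.inl rfl) (by
      intro S v hzS _ hS _ _ hv _
      refine Or.inr ⟨v, Set.mem_insert _ _, ?_, ?_⟩
      · rintro rfl
        exact hv (hzS rfl)
      · rwa [Set.insert_sdiff_self_of_notMem hv])
  rcases this with rfl | h
  · exact absurd hw hwz
  · exact h

end Connectivity

section HubJoin

variable {I X L : Type*}

/-- The join of a complete graph of hubs `I` with a rim graph `R`. -/
def hubJoin (I : Type*) (R : SimpleGraph X) : SimpleGraph (I ⊕ X) where
  Adj p q := match p, q with
    | .inl i, .inl j => i ≠ j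
    | .inl _, .inr _ => True
    | .inr _, .inl _ => True
    | .inr x, .inr y => R.Adj x y
  symm := ⟨by
    rintro (i | x) (j | y) h
    · exact Ne.symm h
    · trivial
    · trivial
    · exact R.adj_symm h⟩
  loopless := ⟨by
    rintro (i | x) h
    · exact h rfl
    · exact R.irrefl h⟩

variable {R : SimpleGraph X}

@[simp] lemma hubJoin_adj_inl_inl {i j : I} :
    (hubJoin I R).Adj (.inl i) (.inl j) ↔ i ≠ j := Iff.rfl

@[simp] lemma hubJoin_adj_inl_inr {i : I} {x : X} : (hubJoin I R).Adj (.inl i) (.inr x) := trivial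

@[simp] lemma hubJoin_adj_inr_inl {i : I} {x : X} : (hubJoin I R).Adj (.inr x) (.inl i) := trivial

@[simp] lemma hubJoin_adj_inr_inr {x y : X} :
    (hubJoin I R).Adj (.inr x) (.inr y) ↔ R.Adj x y := Iff.rfl

lemma hubJoin_adj_inl {i : I} {p : I ⊕ X} (h : p ≠ .inl i) : (hubJoin I R).Adj (.inl i) p := by
  rcases p with j | x
  · exact fun hij => h (by rw [hij])
  · trivial

/-- Only the labels that no hub carries constrain a model of a complete graph. -/
lemma isModel_hubJoin_iff {σ : I → L} {g : X → L} :
    IsModel (hubJoin I R) (⊤ : SimpleGraph L) (Sum.elim σ g) ↔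
      (∀ u ∉ Set.range σ, (R.induce (g ⁻¹' {u})).Connected) ∧
      ∀ u ∉ Set.range σ, ∀ v ∉ Set.range σ, u ≠ v → ∃ x y, R.Adj x y ∧ g x = u ∧ g y = v := by
  have key : ∀ u ∉ Set.range σ, (((hubJoin I R).induce (Sum.elim σ g ⁻¹' {u})).Connected ↔
      (R.induce (g ⁻¹' {u})).Connected) := by
    intro u hu
    refine (Iso.connected_iff (G := R.induce (g ⁻¹' {u})) ⟨Equiv.ofBijective
      (fun x => ⟨.inr x.1, x.2⟩) ⟨fun x y h => ?_, ?_⟩, ?_⟩).symm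
    · simpa [Subtype.ext_iff] using h
    · rintro ⟨i | x, h⟩
      · exact absurd ⟨i, h⟩ hu
      · exact ⟨⟨x, h⟩, rfl⟩
    · intro x y
      exact Iff.rfl
  constructor
  · rintro ⟨h1, h2⟩
    refine ⟨fun u hu => (key u hu).1 (h1 u).2, fun u hu v hv huv => ?_⟩
    obtain ⟨i | x, j | y, h, hx, hy⟩ := h2 ((top_adj u v).2 huv)
    · exact absurd ⟨i, hx⟩ hu
    · exact absurd ⟨i, hx⟩ hu
    · exact absurd ⟨j, hy⟩ hv
    · exact ⟨x, y, h, hx, hy⟩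
  · rintro ⟨h1, h2⟩
    have hne : ∀ u, ∃ p, Sum.elim σ g p = u := by
      intro u
      by_cases hu : u ∈ Set.range σ
      · obtain ⟨i, hi⟩ := hu
        exact ⟨.inl i, hi⟩
      · obtain ⟨x, hx⟩ := (h1 u hu).nonempty
        exact ⟨.inr x, hx⟩
    refine ⟨fun u => ⟨hne u, ?_⟩, fun u v huv => ?_⟩
    · by_cases hu : u ∈ Set.range σ
      · obtain ⟨i, rfl⟩ := hu
        rw [connected_iff_exists_forall_reachable]
        refine ⟨⟨.inl i, rfl⟩, fun w => ?_⟩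
        by_cases hw : w.1 = .inl i
        · rw [Subtype.ext (a1 := w) (a2 := ⟨.inl i, rfl⟩) hw]
        · exact Adj.reachable (G := (hubJoin I R).induce _) (hubJoin_adj_inl hw)
      · exact (key u hu).2 (h1 u hu)
    · have huv' : u ≠ v := huv
      by_cases hu : u ∈ Set.range σ
      · obtain ⟨i, rfl⟩ := hu
        obtain ⟨p, rfl⟩ := hne v
        refine ⟨.inl i, p, hubJoin_adj_inl ?_, rfl, rfl⟩
        rintro rfl
        exact huv' rfl
      by_cases hv : v ∈ Set.range σ
      · obtain ⟨i, rfl⟩ := hv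
        obtain ⟨p, rfl⟩ := hne u
        refine ⟨p, .inl i, (hubJoin_adj_inl ?_).symm, rfl, rfl⟩
        rintro rfl
        exact huv' rfl
      obtain ⟨x, y, h, hx, hy⟩ := h2 u hu v hv huv'
      exact ⟨.inr x, .inr y, h, hx, hy⟩

end HubJoin

section Reachability

variable {V W : Type*} {G : SimpleGraph V} {H : SimpleGraph W}

/-- `g` is reachable from `f` in the reconfiguration graph. -/
abbrev ModelReach (G : SimpleGraph V) (H : SimpleGraph W) : (V → W) → (V → W) → Prop :=
  Relation.ReflTransGen (ModelStep G H)

lemma ModelReach.symm {f g : V → W} (h : ModelReach G H f g) : ModelReach G H g f :=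
  by
  have : Std.Symm (ModelStep G H) :=
    ⟨fun _ _ ⟨h1, h2, v, h3, h4⟩ => ⟨h2, h1, v, h3.symm, fun u hu => (h4 u hu).symm⟩⟩
  exact Relation.ReflTransGen.stdSymm.symm _ _ h

lemma ModelReach.of_eq_off {f g : V → W} (hf : IsModel G H f) (hg : IsModel G H g) (v : V)
    (h : ∀ u, u ≠ v → f u = g u) : ModelReach G H f g := by
  by_cases hv : f v = g v
  · have : f = g := funext fun u => by
      by_cases hu : u = v
      · rw [hu, hv]
      · exact h u hu
    rw [this]
  · exact .single ⟨hf, hg, v, hv, h⟩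

end Reachability

section EdgeMoves

variable {I X L : Type*} {R : SimpleGraph X}

/-- Two disjoint connected vertex sets joined by an edge. -/
structure IsBranchPair (R : SimpleGraph X) (A B : Set X) : Prop where
  disj : Disjoint A B
  left : (R.induce A).Connected
  right : (R.induce B).Connected
  adj : ∃ x ∈ A, ∃ y ∈ B, R.Adj x y

lemma IsBranchPair.symm {A B : Set X} (h : IsBranchPair R A B) : IsBranchPair R B A := by
  obtain ⟨x, hx, y, hy, hxy⟩ := h.adj
  exact ⟨h.disj.symm, h.right, h.left, y, hy, x, hx, hxy.symm⟩

lemma isBranchPair_singleton {x y : X} (h : R.Adj x y) : IsBranchPair R {x} {y} :=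
  ⟨by simpa using h.ne, induce_singleton_connected x, induce_singleton_connected y,
    x, rfl, y, rfl, h⟩

open Classical in
/-- The labelling with label `a` on `A`, `b` on `B` and `c` elsewhere. -/
noncomputable def pairLabel (a b c : L) (A B : Set X) : X → L :=
  fun x => if x ∈ A then a else if x ∈ B then b else c

lemma pairLabel_comm {a b c : L} {A B : Set X} (h : Disjoint A B) :
    pairLabel a b c A B = pairLabel b a c B A := by
  funext x
  have : x ∈ A → x ∉ B := fun hA => Set.disjoint_left.1 h hA
  unfold pairLabel
  grind

/-- The hub labelling `σ` misses exactly the two labels `a` and `b`. -/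
structure MissesExactly (σ : I → L) (a b : L) : Prop where
  ne : a ≠ b
  iff : ∀ u, u ∉ Set.range σ ↔ u = a ∨ u = b

lemma MissesExactly.symm {σ : I → L} {a b : L} (h : MissesExactly σ a b) :
    MissesExactly σ b a :=
  ⟨h.ne.symm, fun u => (h.iff u).trans or_comm⟩

lemma MissesExactly.isModel_iff {σ : I → L} {a b : L} (h : MissesExactly σ a b) {g : X → L} :
    IsModel (hubJoin I R) (⊤ : SimpleGraph L) (Sum.elim σ g) ↔
      IsBranchPair R (g ⁻¹' {a}) (g ⁻¹' {b}) := by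
  rw [isModel_hubJoin_iff]
  simp only [h.iff]
  constructor
  · rintro ⟨h1, h2⟩
    obtain ⟨x, y, hxy, hx, hy⟩ := h2 a (.inl rfl) b (.inr rfl) h.ne
    refine ⟨?_, h1 a (.inl rfl), h1 b (.inr rfl), x, hx, y, hy, hxy⟩
    rw [Set.disjoint_left]
    intro z hz hz'
    exact h.ne (Eq.trans (Eq.symm hz) hz')
  · rintro ⟨-, h1, h2, x, hx, y, hy, hxy⟩
    refine ⟨?_, ?_⟩
    · rintro u (rfl | rfl)
      exacts [h1, h2]
    · rintro u (rfl | rfl) v (rfl | rfl) huv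
      exacts [absurd rfl huv, ⟨x, y, hxy, hx, hy⟩, ⟨y, x, hxy.symm, hy, hx⟩, absurd rfl huv]

lemma MissesExactly.isModel_pairLabel {σ : I → L} {a b : L} (h : MissesExactly σ a b) (i : I)
    {A B : Set X} (hAB : IsBranchPair R A B) :
    IsModel (hubJoin I R) (⊤ : SimpleGraph L) (Sum.elim σ (pairLabel a b (σ i) A B)) := by
  have ha : σ i ≠ a := fun e => (h.iff a).2 (.inl rfl) ⟨i, e⟩
  have hb : σ i ≠ b := fun e => (h.iff b).2 (.inr rfl) ⟨i, e⟩
  have hab := h.ne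
  rw [h.isModel_iff]
  convert hAB using 1 <;> ext x <;>
    have : x ∈ A → x ∉ B := fun hA => Set.disjoint_left.1 hAB.disj hA
  · simp only [pairLabel, Set.mem_preimage, Set.mem_singleton_iff]
    grind
  · simp only [pairLabel, Set.mem_preimage, Set.mem_singleton_iff]
    grind

/-- Reachability between the models given by two pairs of branch sets, under a fixed hub
labelling `σ`. -/
def PairReach (R : SimpleGraph X) (σ : I → L) (a b c : L) (A B A' B' : Set X) : Prop :=
  ModelReach (hubJoin I R) (⊤ : SimpleGraph L)
    (Sum.elim σ (pairLabel a b c A B)) (Sum.elim σ (pairLabel a b c A' B'))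

section

variable {σ : I → L} {a b c : L} {A B A' B' A'' B'' : Set X}

lemma PairReach.symm (h : PairReach R σ a b c A B A' B') : PairReach R σ a b c A' B' A B :=
  ModelReach.symm h

lemma PairReach.trans (h : PairReach R σ a b c A B A' B')
    (h' : PairReach R σ a b c A' B' A'' B'') : PairReach R σ a b c A B A'' B'' :=
  Relation.ReflTransGen.trans h h'

lemma PairReach.swap (h : PairReach R σ a b c A B A' B') (hd : Disjoint A B)
    (hd' : Disjoint A' B') : PairReach R σ b a c B A B' A' := by
  unfold PairReach at h ⊢
  rwa [pairLabel_comm hd, pairLabel_comm hd'] at h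

variable {i : I}

lemma MissesExactly.pairReach_of_eq_off (h : MissesExactly σ a b) (hAB : IsBranchPair R A B)
    (hAB' : IsBranchPair R A' B') (v : X)
    (hv : ∀ z, z ≠ v → ((z ∈ A ↔ z ∈ A') ∧ (z ∈ B ↔ z ∈ B'))) :
    PairReach R σ a b (σ i) A B A' B' := by
  refine ModelReach.of_eq_off (h.isModel_pairLabel i hAB) (h.isModel_pairLabel i hAB') (.inr v) ?_
  rintro (j | z) hz
  · rfl
  · have hz' : z ≠ v := fun e => hz (by rw [e])
    have := hv z hz'
    simp only [Sum.elim_inr, pairLabel]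
    grind

lemma MissesExactly.pairReach_grow_left [Finite X] (h : MissesExactly σ a b)
    (hAB : IsBranchPair R A' B) (hAB' : IsBranchPair R A B) (hsub : A' ⊆ A) :
    PairReach R σ a b (σ i) A' B A B := by
  obtain ⟨x, hx, y, hy, hxy⟩ := hAB.adj
  have hp : ∀ S, A' ⊆ S → S ⊆ A → (R.induce S).Connected → IsBranchPair R S B :=
    fun S h1 h2 h3 => ⟨hAB'.disj.mono_left h2, h3, hAB.right, x, h1 hx, y, hy, hxy⟩
  refine hAB'.left.grow_induction (P := fun S => PairReach R σ a b (σ i) A' B S B)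
    hAB.left hsub .refl ?_
  intro S v h1 h2 h3 h4 h5 h6 h7
  refine h4.trans (h.pairReach_of_eq_off (hp S h1 h2 h3)
    (hp _ (h1.trans (Set.subset_insert _ _)) (Set.insert_subset h5 h2) h7) v ?_)
  intro z hz
  simp [hz]

lemma MissesExactly.pairReach_grow_right [Finite X] (h : MissesExactly σ a b)
    (hAB : IsBranchPair R A B') (hAB' : IsBranchPair R A B) (hsub : B' ⊆ B) :
    PairReach R σ a b (σ i) A B' A B :=
  (h.symm.pairReach_grow_left hAB.symm hAB'.symm hsub).swap hAB.disj.symm hAB'.disj.symm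

lemma MissesExactly.pairReach_edge [Finite X] (h : MissesExactly σ a b)
    (hAB : IsBranchPair R A B) {x y : X} (hx : x ∈ A) (hy : y ∈ B) (hxy : R.Adj x y) :
    PairReach R σ a b (σ i) A B {x} {y} := by
  have h1 : IsBranchPair R {x} B :=
    ⟨hAB.disj.mono_left (by simpa using hx), induce_singleton_connected x, hAB.right,
      x, rfl, y, hy, hxy⟩
  have h2 := isBranchPair_singleton hxy
  exact (h.pairReach_grow_left h1 hAB (by simpa using hx)).symm.trans
    (h.pairReach_grow_right h2 h1 (by simpa using hy)).symm

lemma MissesExactly.pairReach_shift [Finite X] (h : MissesExactly σ a b) {x y z : X}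
    (hxy : R.Adj x y) (hyz : R.Adj y z) (hxz : x ≠ z) :
    PairReach R σ a b (σ i) {x} {y} {y} {z} := by
  have hx := hxy.ne
  have hy := hyz.ne
  have h1 : IsBranchPair R {x} {y, z} :=
    ⟨by simp [hx, hxz], induce_singleton_connected x, induce_pair_connected_of_adj hyz,
      x, rfl, y, by simp, hxy⟩
  have h2 : IsBranchPair R {x, y} {z} :=
    ⟨by simp [hxz.symm, hy.symm], induce_pair_connected_of_adj hxy, induce_singleton_connected z,
      y, by simp, z, rfl, hyz⟩
  refine (h.pairReach_edge h1 rfl (by simp) hxy).symm.trans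
    (PairReach.trans (h.pairReach_of_eq_off h1 h2 y ?_) (h.pairReach_edge h2 (by simp) rfl hyz))
  intro w hw
  simp [hw]

/-- If `y` is not a cut vertex and has two neighbours `x` and `z`, the two labels on the edge
`yz` can be exchanged by walking one of them around `y`. -/
lemma MissesExactly.pairReach_flip [Finite X] (h : MissesExactly σ a b) {x y z : X}
    (hxy : R.Adj x y) (hyz : R.Adj y z) (hxz : x ≠ z)
    (hy : (R.induce ({y}ᶜ : Set X)).Connected) :
    PairReach R σ a b (σ i) {y} {z} {z} {y} := by
  have hx := hxy.ne
  have hz := hyz.ne.symm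
  have h1 : IsBranchPair R {y}ᶜ {y} :=
    ⟨by simp [Set.disjoint_left], hy, induce_singleton_connected y, x, by simpa using hx, y, rfl, hxy⟩
  exact (h.pairReach_shift hxy hyz hxz).symm.trans
    ((h.pairReach_edge h1 (by simpa using hx) rfl hxy).symm.trans
      (h.pairReach_edge h1 (by simpa using hz) rfl hyz.symm))

lemma MissesExactly.pairReach_fixed_edge [Finite X] (h : MissesExactly σ a b) {x₀ y₀ z₀ : X}
    (hR : R.Connected) (hxy : R.Adj x₀ y₀) (hyz : R.Adj y₀ z₀) (hxz : x₀ ≠ z₀)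
    (hy : (R.induce ({y₀}ᶜ : Set X)).Connected) {x y : X} (hadj : R.Adj x y) :
    PairReach R σ a b (σ i) {x} {y} {y₀} {z₀} := by
  have shift : ∀ {x y z}, R.Adj x y → R.Adj y z → x ≠ z →
      PairReach R σ a b (σ i) {x} {y} {y} {z} := fun h1 h2 h3 => h.pairReach_shift h1 h2 h3
  have flip : PairReach R σ a b (σ i) {y₀} {z₀} {z₀} {y₀} := h.pairReach_flip hxy hyz hxz hy
  suffices hD : ∀ y, R.Adj x y → PairReach R σ a b (σ i) {x} {y} {y₀} {z₀} ∧
      PairReach R σ a b (σ i) {y} {x} {y₀} {z₀} from (hD y hadj).1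
  have hreach := (reachable_iff_reflTransGen _ _).1 (hR.preconnected y₀ x)
  clear hadj
  induction hreach with
  | refl =>
    intro w hw
    by_cases hwz : w = z₀
    · subst hwz
      exact ⟨.refl, flip.symm⟩
    · exact ⟨(shift hyz.symm hw (Ne.symm hwz)).symm.trans flip.symm, shift hw.symm hyz hwz⟩
  | @tail x x' _ hxx' ih =>
    obtain ⟨h1, h2⟩ := ih x' hxx'
    intro y hy
    by_cases hyx : y = x
    · subst hyx
      exact ⟨h2, h1⟩
    · exact ⟨(shift hxx' hy (Ne.symm hyx)).symm.trans h1, (shift hy.symm hxx'.symm hyx).trans h2⟩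

end

/-- Rim vertices outside the two constrained branch sets can be relabelled freely. -/
lemma MissesExactly.modelReach_of_same_branch_sets [Finite X] {σ : I → L} {a b : L}
    (h : MissesExactly σ a b) {g g' : X → L}
    (hg : IsModel (hubJoin I R) (⊤ : SimpleGraph L) (Sum.elim σ g))
    (ha : g ⁻¹' {a} = g' ⁻¹' {a}) (hb : g ⁻¹' {b} = g' ⁻¹' {b}) :
    ModelReach (hubJoin I R) (⊤ : SimpleGraph L) (Sum.elim σ g) (Sum.elim σ g') := by
  classical
  have aux : ∀ k : X → L, k ⁻¹' {a} = g ⁻¹' {a} → k ⁻¹' {b} = g ⁻¹' {b} →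
      IsModel (hubJoin I R) (⊤ : SimpleGraph L) (Sum.elim σ k) := by
    intro k h1 h2
    rw [h.isModel_iff] at hg ⊢
    rwa [h1, h2]
  have hag : ∀ x, g x = a ↔ g' x = a := fun x => Set.ext_iff.1 ha x
  have hbg : ∀ x, g x = b ↔ g' x = b := fun x => Set.ext_iff.1 hb x
  let mix : Set X → X → L := fun S => S.piecewise g' g
  have hmix : ∀ S, IsModel (hubJoin I R) (⊤ : SimpleGraph L) (Sum.elim σ (mix S)) := by
    intro S
    refine aux _ ?_ ?_ <;> ext x <;> by_cases hx : x ∈ S <;> simp [mix, hx, hag, hbg]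
  suffices ∀ S : Set X, S.Finite → ModelReach (hubJoin I R) (⊤ : SimpleGraph L) (Sum.elim σ g)
      (Sum.elim σ (mix S)) by
    simpa [mix] using this Set.univ Set.finite_univ
  intro S hS
  induction S, hS using Set.Finite.induction_on with
  | empty => simpa [mix] using Relation.ReflTransGen.refl
  | @insert v S _ _ ih =>
    refine Relation.ReflTransGen.trans ih (ModelReach.of_eq_off (hmix _) (hmix _) (.inr v) ?_)
    rintro (j | z) hz
    · rfl
    · have hz' : z ≠ v := fun e => hz (by rw [e])
      simp [mix, Set.piecewise, hz']

end EdgeMoves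

section HubMoves

variable {I X L : Type*} {R : SimpleGraph X}

/-- A connected rim graph with a vertex `y` that is not a cut vertex and has two distinct
neighbours `x` and `z`. -/
structure IsRim (R : SimpleGraph X) (x y z : X) : Prop where
  adj_left : R.Adj x y
  adj_right : R.Adj y z
  ne : x ≠ z
  compl_connected : (R.induce ({y}ᶜ : Set X)).Connected

lemma IsRim.connected {x y z : X} (h : IsRim R x y z) : R.Connected := by
  have := h.compl_connected.induce_insert (u := z) (by simpa using h.adj_right.ne.symm)
    h.adj_right.symm
  rw [show insert y ({y}ᶜ : Set X) = Set.univ by ext; simp; tauto] at this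
  exact (induceUnivIso R).connected_iff.1 this

lemma MissesExactly.modelReach [Finite X] [Nonempty I] {x y z : X} (hR : IsRim R x y z)
    {σ : I → L} {a b : L} (h : MissesExactly σ a b) {g g' : X → L}
    (hg : IsModel (hubJoin I R) (⊤ : SimpleGraph L) (Sum.elim σ g))
    (hg' : IsModel (hubJoin I R) (⊤ : SimpleGraph L) (Sum.elim σ g')) :
    ModelReach (hubJoin I R) (⊤ : SimpleGraph L) (Sum.elim σ g) (Sum.elim σ g') := by
  obtain ⟨i⟩ := ‹Nonempty I›
  have aux : ∀ g : X → L, IsModel (hubJoin I R) (⊤ : SimpleGraph L) (Sum.elim σ g) →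
      ModelReach (hubJoin I R) (⊤ : SimpleGraph L) (Sum.elim σ g)
        (Sum.elim σ (pairLabel a b (σ i) {y} {z})) := by
    intro g hg
    have hp := h.isModel_iff.1 hg
    obtain ⟨u, hu, v, hv, huv⟩ := hp.adj
    have ha : σ i ≠ a := fun e => (h.iff a).2 (.inl rfl) ⟨i, e⟩
    have hb : σ i ≠ b := fun e => (h.iff b).2 (.inr rfl) ⟨i, e⟩
    have hab := h.ne
    have h1 : ModelReach (hubJoin I R) (⊤ : SimpleGraph L) (Sum.elim σ g)
        (Sum.elim σ (pairLabel a b (σ i) (g ⁻¹' {a}) (g ⁻¹' {b}))) := by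
      refine h.modelReach_of_same_branch_sets hg ?_ ?_ <;> ext w <;>
        simp only [pairLabel, Set.mem_preimage, Set.mem_singleton_iff] <;> grind
    exact h1.trans ((h.pairReach_edge hp hu hv huv).trans
      (h.pairReach_fixed_edge hR.connected hR.adj_left hR.adj_right hR.ne hR.compl_connected huv))
  exact (aux g hg).trans (aux g' hg').symm

open Function

lemma exists_missesExactly [Fintype I] [Fintype L] (hL : Fintype.card L = Fintype.card I + 2)
    {σ : I → L} (hσ : Injective σ) : ∃ a b, MissesExactly σ a b := by
  classical
  have : (Finset.univ.image σ)ᶜ.card = 2 := by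
    rw [Finset.card_compl, Finset.card_image_of_injective _ hσ, Finset.card_univ, hL]
    omega
  obtain ⟨a, b, hab, h⟩ := Finset.card_eq_two.1 this
  refine ⟨a, b, hab, fun u => ?_⟩
  simpa using Finset.ext_iff.1 h u

/-- Under a rim, a single hub can be moved to a label that no hub uses. -/
lemma MissesExactly.exists_modelStep_update [Finite X] [DecidableEq I] {x y z : X}
    (hR : IsRim R x y z) {σ : I → L} (hσ : Injective σ) {a b : L} (h : MissesExactly σ a b)
    (i : I) :
    ∃ g : X → L, IsModel (hubJoin I R) (⊤ : SimpleGraph L) (Sum.elim σ g) ∧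
      IsModel (hubJoin I R) (⊤ : SimpleGraph L) (Sum.elim (update σ i b) g) ∧
      MissesExactly (update σ i b) a (σ i) := by
  have hzy : z ∈ ({y}ᶜ : Set X) := by simpa using hR.adj_right.ne.symm
  obtain ⟨w, hw, hwz, hconn⟩ := hR.compl_connected.exists_induce_diff_singleton_connected
    hzy (by simpa using hR.adj_left.ne) hR.ne
  have hwy : w ≠ y := hw
  have ha : σ i ≠ a := fun e => (h.iff a).2 (.inl rfl) ⟨i, e⟩
  have hb : σ i ≠ b := fun e => (h.iff b).2 (.inr rfl) ⟨i, e⟩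
  have hzA : z ∈ ({y}ᶜ \ {w} : Set X) := ⟨hzy, Ne.symm hwz⟩
  obtain ⟨u, hu, v, hv, hvA, huv⟩ := hR.compl_connected.exists_adj_of_ssubset
    (S := {y}ᶜ \ {w}) ⟨Set.sdiff_subset, fun hs => (hs hw).2 rfl⟩ ⟨z, hzA⟩
  obtain rfl : v = w := by
    by_contra hne
    exact hvA ⟨hv, hne⟩
  have h' : MissesExactly (update σ i b) a (σ i) := by
    refine ⟨ha.symm, fun u => ?_⟩
    have := h.iff u
    have hab := h.ne
    rw [← not_iff_not, not_not] at this ⊢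
    constructor
    · rintro ⟨j, rfl⟩
      by_cases hj : j = i
      · subst hj
        simp [Ne.symm hab, Ne.symm hb]
      · have hja : σ j ≠ a := fun e => (h.iff a).2 (.inl rfl) ⟨j, e⟩
        simp [hj, hja, hσ.ne hj]
    · intro hu
      push Not at hu
      by_cases hub : u = b
      · exact ⟨i, by simp [hub]⟩
      · obtain ⟨j, rfl⟩ := this.2 (by simp [hu.1, hub])
        have hj : j ≠ i := by
          rintro rfl
          exact hu.2 rfl
        exact ⟨j, by simp [hj]⟩
  refine ⟨pairLabel a b (σ i) ({y}ᶜ \ {v}) {y}, h.isModel_pairLabel i ?_, ?_, h'⟩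
  · exact ⟨by simp [Set.disjoint_left]; tauto, hconn, induce_singleton_connected y, z, hzA, y, rfl,
      hR.adj_right.symm⟩
  · have e : pairLabel a b (σ i) ({y}ᶜ \ {v}) {y} =
        pairLabel a (σ i) (update σ i b i) ({y}ᶜ \ {v}) {v} := by
      funext t
      simp only [pairLabel, update_self]
      grind
    rw [e]
    refine h'.isModel_pairLabel i ?_
    exact ⟨by simp [Set.disjoint_left], hconn, induce_singleton_connected v, u, hu, v, rfl, huv⟩

lemma modelReach_of_injective_hubs [Finite X] [Nonempty I] [Fintype I] [Fintype L]
    (hL : Fintype.card L = Fintype.card I + 2) {x y z : X} (hR : IsRim R x y z)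
    {σ τ : I → L} (hσ : Injective σ) (hτ : Injective τ) {g g' : X → L}
    (hg : IsModel (hubJoin I R) (⊤ : SimpleGraph L) (Sum.elim σ g))
    (hg' : IsModel (hubJoin I R) (⊤ : SimpleGraph L) (Sum.elim τ g')) :
    ModelReach (hubJoin I R) (⊤ : SimpleGraph L) (Sum.elim σ g) (Sum.elim τ g') := by
  classical
  -- a hub can be moved to any unused label
  have move : ∀ {σ : I → L} {g : X → L}, Injective σ →
      IsModel (hubJoin I R) (⊤ : SimpleGraph L) (Sum.elim σ g) → ∀ i, ∀ b ∉ Set.range σ,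
      Injective (update σ i b) ∧
      ∃ k, IsModel (hubJoin I R) (⊤ : SimpleGraph L) (Sum.elim (update σ i b) k) ∧
      ModelReach (hubJoin I R) (⊤ : SimpleGraph L) (Sum.elim σ g)
        (Sum.elim (update σ i b) k) := by
    intro σ g hσ hg i b hb
    obtain ⟨a, hab⟩ : ∃ a, MissesExactly σ a b := by
      obtain ⟨a, a', h⟩ := exists_missesExactly hL hσ
      rcases (h.iff b).1 hb with rfl | rfl
      exacts [⟨a', h.symm⟩, ⟨a, h⟩]
    obtain ⟨k, h1, h2, -⟩ := hab.exists_modelStep_update hR hσ i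
    refine ⟨?_, k, h2, Relation.ReflTransGen.trans (hab.modelReach hR hg h1)
      (ModelReach.of_eq_off h1 h2 (.inl i) ?_)⟩
    · intro p q hpq
      simp only [update_apply] at hpq
      have := @hσ p q
      simp only [Set.mem_range, not_exists] at hb
      grind
    · rintro (j | w) hj
      · have : j ≠ i := fun e => hj (by rw [e])
        simp [this]
      · rfl
  induction hn : (Finset.univ.filter fun i => σ i ≠ τ i).card using Nat.strong_induction_on
    generalizing σ g with
  | _ n ih =>
  by_cases hστ : σ = τ
  · subst hστ
    obtain ⟨a, b, h⟩ := exists_missesExactly hL hσ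
    exact h.modelReach hR hg hg'
  obtain ⟨i, hi⟩ := Function.ne_iff.1 hστ
  -- free the target label of hub `i` if some other hub uses it
  obtain ⟨ρ, k, hρ, hk, hreach, hfree, hρi⟩ : ∃ (ρ : I → L) (k : X → L), Injective ρ ∧
      IsModel (hubJoin I R) (⊤ : SimpleGraph L) (Sum.elim ρ k) ∧
      ModelReach (hubJoin I R) (⊤ : SimpleGraph L) (Sum.elim σ g) (Sum.elim ρ k) ∧
      τ i ∉ Set.range ρ ∧ ∀ j, σ j = τ j → ρ j = τ j := by
    by_cases hmem : τ i ∈ Set.range σ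
    · obtain ⟨j, hj⟩ := hmem
      obtain ⟨a, b, h⟩ := exists_missesExactly hL hσ
      have ha : a ∉ Set.range σ := (h.iff a).2 (.inl rfl)
      obtain ⟨h1, k, h2, h3⟩ := move hσ hg j a ha
      refine ⟨_, k, h1, h2, h3, ?_, ?_⟩
      · rintro ⟨p, hp⟩
        by_cases hpj : p = j
        · subst hpj
          rw [update_self] at hp
          exact ha ⟨p, hj.trans hp.symm⟩
        · rw [update_of_ne hpj] at hp
          exact hpj (hσ (hp.trans hj.symm))
      · intro p hp
        have hpj : p ≠ j := by
          rintro rfl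
          exact hi (hτ (hp.symm.trans hj) ▸ hp)
        rw [update_of_ne hpj, hp]
    · exact ⟨σ, g, hσ, hg, .refl, hmem, fun j hj => hj⟩
  obtain ⟨h1, k', h2, h3⟩ := move hρ hk i (τ i) hfree
  refine hreach.trans (h3.trans (ih _ ?_ h1 h2 rfl))
  rw [← hn]
  refine Finset.card_lt_card ⟨fun j => ?_, fun hs => ?_⟩
  · simp only [Finset.mem_filter, Finset.mem_univ, true_and, update_apply]
    grind
  · have := @hs i (by simpa using hi)
    simp at this

/-- Spreading duplicate hub labels over unused labels makes the hub labelling injective. -/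
lemma exists_modelReach_injective_hubs [Fintype I] [Fintype L]
    (hL : Fintype.card I ≤ Fintype.card L) {σ : I → L} {g : X → L}
    (hg : IsModel (hubJoin I R) (⊤ : SimpleGraph L) (Sum.elim σ g)) :
    ∃ τ : I → L, Injective τ ∧ IsModel (hubJoin I R) (⊤ : SimpleGraph L) (Sum.elim τ g) ∧
      ModelReach (hubJoin I R) (⊤ : SimpleGraph L) (Sum.elim σ g) (Sum.elim τ g) := by
  classical
  induction hn : (Finset.univ.image σ)ᶜ.card using Nat.strong_induction_on generalizing σ with
  | _ n ih =>
  by_cases hσ : Injective σ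
  · exact ⟨σ, hσ, hg, .refl⟩
  obtain ⟨i, j, hij, hne⟩ : ∃ i j, σ i = σ j ∧ i ≠ j := by
    simpa [Injective] using hσ
  have hcard : (Finset.univ.image σ).card < Fintype.card I := by
    refine lt_of_le_of_ne Finset.card_image_le fun h => hσ ?_
    simpa using Finset.card_image_iff.1 h
  obtain ⟨u, hu⟩ : ∃ u, u ∉ Set.range σ := by
    by_contra! hall
    have : Finset.univ.image σ = Finset.univ := by
      ext u
      simpa using hall u
    rw [this, Finset.card_univ] at hcard
    omega
  have hsub : Set.range σ ⊆ Set.range (update σ i u) := by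
    rintro _ ⟨p, rfl⟩
    by_cases hp : p = i
    · exact ⟨j, by rw [update_of_ne hne.symm, hp, hij]⟩
    · exact ⟨p, by rw [update_of_ne hp]⟩
  have hmodel : IsModel (hubJoin I R) (⊤ : SimpleGraph L) (Sum.elim (update σ i u) g) := by
    rw [isModel_hubJoin_iff] at hg ⊢
    exact ⟨fun v hv => hg.1 v (fun h => hv (hsub h)),
      fun v hv w hw => hg.2 v (fun h => hv (hsub h)) w (fun h => hw (hsub h))⟩
  obtain ⟨τ, h1, h2, h3⟩ := ih _ (by
    rw [← hn]
    refine Finset.card_lt_card (Finset.compl_ssubset_compl.2 ⟨fun v hv => ?_, fun hs => hu ?_⟩)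
    · simpa using hsub (by simpa using hv)
    · have := @hs u (Finset.mem_image.2 ⟨i, Finset.mem_univ _, update_self _ _ _⟩)
      simpa using this) hmodel rfl
  refine ⟨τ, h1, h2, Relation.ReflTransGen.trans (ModelReach.of_eq_off hg hmodel (.inl i) ?_) h3⟩
  rintro (p | w) hp
  · have : p ≠ i := fun e => hp (by rw [e])
    simp [this]
  · rfl

theorem inHost_hubJoin [Finite X] [Nonempty I] [Fintype I] [Fintype L]
    (hL : Fintype.card L = Fintype.card I + 2) {x y z : X} (hR : IsRim R x y z) :
    InHost (hubJoin I R) (⊤ : SimpleGraph L) := by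
  classical
  refine ⟨?_, fun f f' hf hf' => ?_⟩
  · obtain ⟨σ⟩ := Function.Embedding.nonempty_of_card_le (α := I) (β := L) (by omega)
    obtain ⟨a, b, h⟩ := exists_missesExactly hL σ.injective
    exact ⟨_, h.isModel_pairLabel (Classical.arbitrary I) (isBranchPair_singleton hR.adj_left)⟩
  · have split : ∀ f : I ⊕ X → L, f = Sum.elim (f ∘ .inl) (f ∘ .inr) := fun f =>
      (Sum.elim_comp_inl_inr f).symm
    rw [split f] at hf ⊢
    rw [split f'] at hf' ⊢
    obtain ⟨σ, h1, h2, h3⟩ := exists_modelReach_injective_hubs (by omega) hf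
    obtain ⟨τ, h1', h2', h3'⟩ := exists_modelReach_injective_hubs (by omega) hf'
    exact h3.trans ((modelReach_of_injective_hubs hL hR h1 h1' h2 h2').trans h3'.symm)

end HubMoves

section GenWheel

variable {l m n : ℕ} {Gs : Fin m → SimpleGraph (Fin n)}

/-- The subgraph of a generalized wheel on its subgraph vertices. -/
def wheelRim (m n : ℕ) (Gs : Fin m → SimpleGraph (Fin n)) : SimpleGraph (Fin m × Fin n) :=
  SimpleGraph.fromRel fun p q =>
    (p.1 = q.1 ∧ (Gs p.1).Adj p.2 q.2) ∨ (p.2 = q.2 ∧ (q.1 : ℕ) = ((p.1 : ℕ) + 1) % m)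

lemma genWheel_eq_hubJoin (l m n : ℕ) (Gs : Fin m → SimpleGraph (Fin n)) :
    genWheel l m n Gs = hubJoin (Fin l) (wheelRim m n Gs) := by
  ext (i | p) (j | q) <;> simp [genWheel, wheelRim, fromRel_adj]

lemma wheelRim_adj_layer {i : Fin m} {j k : Fin n} (h : (Gs i).Adj j k) :
    (wheelRim m n Gs).Adj (i, j) (i, k) :=
  (fromRel_adj _ _ _).2 ⟨fun e => h.ne (Prod.ext_iff.1 e).2, .inl (.inl ⟨rfl, h⟩)⟩

lemma wheelRim_adj_next (hm : 2 ≤ m) {i k : Fin m} (j : Fin n) (h : (k : ℕ) = ((i : ℕ) + 1) % m) :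
    (wheelRim m n Gs).Adj (i, j) (k, j) := by
  refine (fromRel_adj _ _ _).2 ⟨fun e => ?_, .inl (.inr ⟨rfl, h⟩)⟩
  have : i = k := (Prod.ext_iff.1 e).1
  subst this
  have hi := i.2
  by_cases h' : (i : ℕ) + 1 = m
  · rw [h', Nat.mod_self] at h
    omega
  · rw [Nat.mod_eq_of_lt (by omega)] at h
    omega

lemma isRim_wheelRim (hm : 3 ≤ m) (hGs : ∀ i, (Gs i).Connected) (j₀ : Fin n) :
    IsRim (wheelRim m n Gs) (⟨m - 1, by omega⟩, j₀) (⟨0, by omega⟩, j₀) (⟨1, by omega⟩, j₀) where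
  adj_left := wheelRim_adj_next (by omega) _ (by simp [Nat.sub_add_cancel (by omega : 1 ≤ m)])
  adj_right := wheelRim_adj_next (by omega) _ (by simp [Nat.mod_eq_of_lt (by omega : 1 < m)])
  ne := by simp; omega
  compl_connected := by
    set R := wheelRim m n Gs
    let y₀ : Fin m × Fin n := (⟨0, by omega⟩, j₀)
    let K := R.induce ({y₀}ᶜ : Set (Fin m × Fin n))
    have mem : ∀ (i : ℕ) (hi : i < m) (j : Fin n), 1 ≤ i →
        ((⟨i, hi⟩, j) : Fin m × Fin n) ∈ ({y₀}ᶜ : Set _) := by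
      intro i hi j h1
      simp [y₀]
      omega
    have layer : ∀ (i : ℕ) (hi : i < m) (h1 : 1 ≤ i) (j k : Fin n),
        K.Reachable ⟨(⟨i, hi⟩, j), mem i hi j h1⟩ ⟨(⟨i, hi⟩, k), mem i hi k h1⟩ := by
      intro i hi h1 j k
      exact ((hGs ⟨i, hi⟩).preconnected j k).map
        (⟨fun j => ⟨(⟨i, hi⟩, j), mem i hi j h1⟩, fun h => wheelRim_adj_layer h⟩ : Gs ⟨i, hi⟩ →g K)
    have base : ∀ (i : ℕ) (h1 : 1 ≤ i) (hi : i < m),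
        K.Reachable ⟨(⟨1, by omega⟩, j₀), mem 1 _ j₀ le_rfl⟩ ⟨(⟨i, hi⟩, j₀), mem i hi j₀ h1⟩ := by
      intro i h1
      induction i, h1 using Nat.le_induction with
      | base => exact fun _ => .refl _
      | succ i h1 ih =>
        intro hi
        refine (ih (by omega)).trans (Adj.reachable (G := K) ?_)
        exact wheelRim_adj_next (by omega) _ (Nat.mod_eq_of_lt hi).symm
    refine (connected_iff_exists_forall_reachable _).2 ⟨⟨(⟨1, by omega⟩, j₀), mem 1 _ j₀ le_rfl⟩, ?_⟩
    rintro ⟨⟨⟨i, hi⟩, j⟩, hij⟩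
    rcases Nat.eq_zero_or_pos i with rfl | h1
    · refine (layer 1 (by omega) le_rfl j₀ j).trans (Adj.reachable (G := K) ?_)
      exact (wheelRim_adj_next (by omega) _ (Nat.mod_eq_of_lt (by omega)).symm).symm
    · exact (base i h1 hi).trans (layer i hi h1 j₀ j)

end GenWheel

/-- For all positive integers `ℓ`, `n`, all `m ≥ 3`, and all connected
graphs `G₁, …, G_m` on `n` vertices each, the generalized wheel
`W(G₁, …, G_m, n, ℓ, m)` is in `host(K_{ℓ+2})`. -/
theorem stmt3 (l n m : ℕ) (hl : 1 ≤ l) (hn : 1 ≤ n) (hm : 3 ≤ m)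
    (Gs : Fin m → SimpleGraph (Fin n)) (hGs : ∀ i : Fin m, (Gs i).Connected) :
    InHost (genWheel l m n Gs) (⊤ : SimpleGraph (Fin (l + 2))) := by
  have : Nonempty (Fin l) := ⟨⟨0, hl⟩⟩
  rw [genWheel_eq_hubJoin]
  exact inHost_hubJoin (by simp) (isRim_wheelRim hm hGs ⟨0, hn⟩)
end

section
/- For all integers m > ℓ ≥ 1, the complete graph K_m is in host(K_ℓ): any two K_ℓ-models of K_m are connected by a sequence of K_ℓ-models in which consecutive models differ on exactly one vertex. -/
open SimpleGraph

/-- A model of a complete graph in a complete graph is a surjective labelling. -/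
theorem isModel_top_iff {V W : Type*} (f : V → W) :
    IsModel (⊤ : SimpleGraph V) (⊤ : SimpleGraph W) f ↔ Function.Surjective f := by
  refine ⟨fun h i ↦ (h.1 i).1, fun h ↦ ⟨fun i ↦ ?_, fun i j hij ↦ ?_⟩⟩
  · obtain ⟨v, hv⟩ := h i
    refine ⟨⟨v, hv⟩, ?_⟩
    have : Nonempty (f ⁻¹' {i}) := ⟨⟨v, hv⟩⟩
    rw [SimpleGraph.induce_top]
    exact SimpleGraph.connected_top
  · obtain ⟨u, rfl⟩ := h i
    obtain ⟨v, rfl⟩ := h j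
    exact ⟨u, v, fun huv ↦ hij (congrArg f huv), rfl, rfl⟩

instance ModelStep.stdSymm {V W : Type*} (G : SimpleGraph V) (H : SimpleGraph W) :
    Std.Symm (ModelStep G H) where
  symm := fun _ _ ⟨hf, hg, v, hv, huv⟩ ↦ ⟨hg, hf, v, hv.symm, fun u hu ↦ (huv u hu).symm⟩

/-- Relabelling a vertex that shares its label keeps a labelling surjective. -/
theorem surjective_update_of_eq {V W : Type*} [DecidableEq V] {f : V → W}
    (hf : Function.Surjective f) {v y : V} (hyv : y ≠ v) (hy : f y = f v) (c : W) :
    Function.Surjective (Function.update f v c) := by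
  intro i
  obtain ⟨u, rfl⟩ := hf i
  by_cases huv : u = v
  · subst huv
    exact ⟨y, by rw [Function.update_of_ne hyv, hy]⟩
  · exact ⟨u, Function.update_of_ne huv _ _⟩

theorem reach_update_of_eq {V W : Type*} [DecidableEq V] {f : V → W}
    (hf : Function.Surjective f) {v y : V} (hyv : y ≠ v) (hy : f y = f v) (c : W) :
    Relation.ReflTransGen (ModelStep (⊤ : SimpleGraph V) (⊤ : SimpleGraph W))
      f (Function.update f v c) := by
  by_cases hc : f v = c
  · rw [← hc, Function.update_eq_self]
  · refine .single ⟨(isModel_top_iff f).2 hf,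
      (isModel_top_iff _).2 (surjective_update_of_eq hf hyv hy c), v, ?_, fun u hu ↦ ?_⟩
    · rwa [Function.update_self]
    · rw [Function.update_of_ne hu]

/-- Any two surjective labellings with more vertices than labels can be reconfigured into
each other; the induction is on the number of vertices where they disagree. -/
theorem reach_of_surjective {V W : Type*} [Fintype V] [DecidableEq V] [Fintype W]
    [DecidableEq W] (hcard : Fintype.card W < Fintype.card V) (n : ℕ) (f g : V → W)
    (hf : Function.Surjective f) (hg : Function.Surjective g)
    (hn : (Finset.univ.filter fun v ↦ f v ≠ g v).card = n) :
    Relation.ReflTransGen (ModelStep (⊤ : SimpleGraph V) (⊤ : SimpleGraph W)) f g := by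
  induction n using Nat.strong_induction_on generalizing f g with
  | _ n ih =>
  by_cases hfg : f = g
  · rw [hfg]
  by_cases hA : ∃ v y, f v ≠ g v ∧ y ≠ v ∧ f y = f v
  · obtain ⟨v, y, hv, hyv, hy⟩ := hA
    refine (reach_update_of_eq hf hyv hy (g v)).trans
      (ih _ ?_ _ g (surjective_update_of_eq hf hyv hy _) hg rfl)
    rw [← hn]
    refine Finset.card_lt_card (Finset.ssubset_iff_of_subset ?_ |>.2 ⟨v, by simpa, by simp⟩)
    intro u
    by_cases hu : u = v <;> simp [hu]
  by_cases hB : ∃ v y, f v ≠ g v ∧ y ≠ v ∧ g y = g v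
  · obtain ⟨v, y, hv, hyv, hy⟩ := hB
    refine .trans (ih _ ?_ f _ hf (surjective_update_of_eq hg hyv hy (f v)) rfl)
      (Std.Symm.symm _ _ (reach_update_of_eq hg hyv hy (f v)))
    rw [← hn]
    refine Finset.card_lt_card (Finset.ssubset_iff_of_subset ?_ |>.2 ⟨v, by simpa, by simp⟩)
    intro u
    by_cases hu : u = v <;> simp [hu]
  push Not at hA hB
  obtain ⟨x, y, hxy, hfxy⟩ := Fintype.exists_ne_map_eq_of_card_lt f hcard
  obtain ⟨v, hv⟩ := Function.ne_iff.1 hfg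
  obtain ⟨w, hw⟩ := hf (g v)
  have hwv : w ≠ v := fun h ↦ hv (by rw [← hw, h])
  have hwD : f w ≠ g w := fun h ↦ hB v w hv hwv (by rw [← h, hw])
  obtain ⟨z, hz⟩ := hf (g w)
  have hzw : z ≠ w := fun h ↦ hwD (by rw [← hz, h])
  have hzD : f z ≠ g z := fun h ↦ hB w z hwD hzw (by rw [← h, hz])
  have hxD : f x = g x := by
    by_contra h
    exact hA x y h hxy.symm hfxy.symm
  have hxw : x ≠ w := fun h ↦ hwD (h ▸ hxD)
  have hxz : x ≠ z := fun h ↦ hzD (h ▸ hxD)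
  -- `x` takes the label of `w`, which frees `w`, which in turn frees `z`.
  have s₁ := surjective_update_of_eq hf hxy.symm hfxy.symm (g v)
  have e₁ : Function.update f x (g v) x = Function.update f x (g v) w := by
    simp [hxw.symm, hw]
  have s₂ := surjective_update_of_eq s₁ hxw e₁ (g w)
  have e₂ : Function.update (Function.update f x (g v)) w (g w) w =
      Function.update (Function.update f x (g v)) w (g w) z := by
    simp [hxz.symm, hzw, hz]
  have s₃ := surjective_update_of_eq s₂ hzw.symm e₂ (g z)
  refine (reach_update_of_eq hf hxy.symm hfxy.symm (g v)).trans
    ((reach_update_of_eq s₁ hxw e₁ (g w)).trans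
      ((reach_update_of_eq s₂ hzw.symm e₂ (g z)).trans (ih _ ?_ _ g s₃ hg rfl)))
  rw [← hn]
  set D := Finset.univ.filter fun v ↦ f v ≠ g v with hD
  have hwm : w ∈ D := by simpa [hD]
  have hzm : z ∈ D.erase w := by simpa [hD, hzw]
  have hsub : (Finset.univ.filter fun u ↦ Function.update (Function.update
      (Function.update f x (g v)) w (g w)) z (g z) u ≠ g u) ⊆
      insert x ((D.erase w).erase z) := by
    intro u
    by_cases huz : u = z
    · simp [huz]
    by_cases huw : u = w
    · simp [huw, hzw.symm]
    by_cases hux : u = x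
    · simp [hux]
    · simp [huz, huw, hux, hD]
  have h₁ := Finset.card_le_card hsub
  have h₂ := Finset.card_insert_le x ((D.erase w).erase z)
  have h₃ := Finset.card_erase_add_one hwm
  have h₄ := Finset.card_erase_add_one hzm
  omega

/-- For all integers `m > ℓ ≥ 1`, the complete graph `K_m` is in
`host(K_ℓ)`. -/
theorem stmt5 (m l : ℕ) (hl : 1 ≤ l) (hlm : l < m) :
    InHost (⊤ : SimpleGraph (Fin m)) (⊤ : SimpleGraph (Fin l)) := by
  refine ⟨?_, fun f g hf hg ↦ ?_⟩
  · refine ⟨fun v ↦ ⟨v % l, Nat.mod_lt _ hl⟩, (isModel_top_iff _).2 fun i ↦ ?_⟩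
    exact ⟨⟨i, i.2.trans hlm⟩, Fin.ext (Nat.mod_eq_of_lt i.2)⟩
  · exact reach_of_surjective (by simpa using hlm) _ f g ((isModel_top_iff f).1 hf)
      ((isModel_top_iff g).1 hg) rfl
end

section
/- Given a graph G, an H-model f of G, a vertex v with f(v) = a, and a label b ≠ a, the map g with g(v) = b and g(u) = f(u) for all u ≠ v is an H-model of G if and only if the following four conditions all hold: (1) the branch set G(f,a) has more than one vertex; (2) v is not a cut vertex of G(f,a); (3) v has at least one neighbour in G(f,b); and (4) v is not a b-crucial vertex. -/
open SimpleGraph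

lemma SimpleGraph.Connected.exists_adj_mem_of_induce {V : Type*} {G : SimpleGraph V} {s : Set V}
    (h : (G.induce s).Connected) {v x : V} (hv : v ∈ s) (hx : x ∈ s) (hxv : x ≠ v) :
    ∃ u ∈ s, G.Adj v u := by
  have : Nontrivial s := ⟨⟨x, hx⟩, ⟨v, hv⟩, by simpa using hxv⟩
  obtain ⟨u, hu⟩ := h.preconnected.exists_adj_of_nontrivial ⟨v, hv⟩
  exact ⟨u, u.2, hu⟩

section Relabel

variable {V W : Type*} [DecidableEq V] (f : V → W) (v : V) (b : W)

lemma preimage_update_self : Function.update f v b ⁻¹' {b} = insert v (f ⁻¹' {b}) := by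
  ext u
  by_cases h : u = v <;> simp [h]

lemma preimage_update_of_ne {i : W} (h : i ≠ b) :
    Function.update f v b ⁻¹' {i} = f ⁻¹' {i} \ {v} := by
  ext u
  by_cases hu : u = v <;> simp [hu, h.symm]

end Relabel

/-- a vertex `v` with `f v = a` can be relabeled to `b ≠ a` (yielding
another `H`-model) if and only if `|G(f,a)| > 1`, `v` is not a cut vertex of `G(f,a)`,
`v` has a neighbour in `G(f,b)`, and `v` is not `b`-crucial. -/
theorem stmt7 {V W : Type} [Fintype V] [DecidableEq V] (G : SimpleGraph V)
    (H : SimpleGraph W) (f : V → W) (hf : IsModel G H f) (v : V) (a b : W)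
    (hva : f v = a) (hba : b ≠ a) :
    IsModel G H (Function.update f v b) ↔
      (1 < (f ⁻¹' {a}).ncard ∧
       ¬ IsCutVertexOf G (f ⁻¹' {a}) v ∧
       (∃ u : V, G.Adj v u ∧ f u = b) ∧
       ¬ IsBCrucial G H f v b) := by
  subst hva
  have hA := preimage_update_of_ne f v b hba.symm
  have hB := preimage_update_self f v b
  constructor
  · rintro ⟨hconn, hedge⟩
    refine ⟨?_, ?_, ?_, ?_⟩
    · obtain ⟨x, hx⟩ := (hconn (f v)).1
      rw [hA] at hx
      exact (Set.one_lt_ncard_iff (Set.toFinite _)).2 ⟨x, v, hx.1, rfl, hx.2⟩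
    · rintro ⟨-, u, w, huw⟩
      have h := (hconn (f v)).2
      rw [hA] at h
      exact huw (h.preconnected u w)
    · obtain ⟨y, hy⟩ := (hf.1 b).1
      have h := (hconn b).2
      rw [hB] at h
      have hyv : y ≠ v := fun e => hba (by rw [← e]; exact hy.symm)
      obtain ⟨u, hu, huv⟩ := h.exists_adj_mem_of_induce (Set.mem_insert _ _)
        (Set.mem_insert_of_mem _ hy) hyv
      exact ⟨u, huv, hu.resolve_left huv.ne'⟩
    · rintro ⟨-, c, -, hcb, hadj, hess⟩
      obtain ⟨u, w, huw, hu, hw⟩ := hedge hadj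
      have huv : u ≠ v := by
        rintro rfl
        exact hba (by simpa using hu)
      have hwv : w ≠ v := by
        rintro rfl
        exact hcb (by simpa using hw.symm)
      rw [Function.update_of_ne huv] at hu
      rw [Function.update_of_ne hwv] at hw
      exact huv (hess u w huw hu hw)
  · rintro ⟨hcard, hcut, ⟨y, hvy, hy⟩, hcrucial⟩
    obtain ⟨x, hx, hxv⟩ := Set.exists_ne_of_one_lt_ncard hcard v
    have hedge_left : ∀ c, H.Adj (f v) c → ∃ u w, G.Adj u w ∧
        Function.update f v b u = f v ∧ Function.update f v b w = c := by
      intro c hc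
      by_cases hcb : c = b
      · subst hcb
        obtain ⟨u, hu, hvu⟩ := (hf.1 (f v)).2.exists_adj_mem_of_induce rfl hx hxv
        exact ⟨u, v, hvu.symm, by rw [Function.update_of_ne hvu.ne']; exact hu, by simp⟩
      · by_contra! hno
        refine hcrucial ⟨⟨y, hvy, hy⟩, c, hc.ne', hcb, hc, fun u w huw hu hw => ?_⟩
        by_contra huv
        have hwv : w ≠ v := fun e => hc.ne (by rw [← hw, e])
        exact hno u w huw (by rwa [Function.update_of_ne huv])
          (by rwa [Function.update_of_ne hwv])
    refine ⟨fun i => ?_, fun i j hij => ?_⟩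
    · suffices (G.induce (Function.update f v b ⁻¹' {i})).Connected from
        ⟨Set.nonempty_coe_sort.1 this.nonempty, this⟩
      by_cases hib : i = b
      · subst hib
        rw [hB]
        have : Subsingleton ↥({v} : Set V) := Set.subsingleton_singleton.coe_sort
        exact connected_induce_union (s := {v}) Preconnected.of_subsingleton (hf.1 i).2.preconnected
          (Set.mem_singleton v) hy hvy
      · rw [preimage_update_of_ne f v b hib]
        by_cases hia : i = f v
        · subst hia
          have : Nonempty ↥(f ⁻¹' {f v} \ {v}) := ⟨⟨x, hx, hxv⟩⟩
          refine ⟨fun u w => ?_⟩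
          by_contra h
          exact hcut ⟨rfl, u, w, h⟩
        · rw [Set.sdiff_singleton_eq_self fun h => hia h.symm]
          exact (hf.1 i).2
    · by_cases hi : i = f v
      · subst hi
        exact hedge_left j hij
      by_cases hj : j = f v
      · subst hj
        obtain ⟨u, w, huw, hu, hw⟩ := hedge_left i hij.symm
        exact ⟨w, u, huw.symm, hw, hu⟩
      obtain ⟨u, w, huw, rfl, rfl⟩ := hf.2 hij
      refine ⟨u, w, huw, Function.update_of_ne ?_ _ _, Function.update_of_ne ?_ _ _⟩
      · exact fun e => hi (congrArg f e)
      · exact fun e => hj (congrArg f e)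
end

section
/- Given a graph G, an H-model f of G, a vertex v with f(v) = a, and a label b ≠ a, if the branch set G(f,a) contains a vertex u ≠ v that is a universal vertex of G, and v has at least one neighbour in G(f,b), then the map g with g(v) = b and g(u') = f(u') for all u' ≠ v is an H-model of G. -/
open SimpleGraph

/-- A set of vertices containing a vertex adjacent to all its other members induces a connected
subgraph. -/
theorem SimpleGraph.induce_connected_of_forall_adj {V : Type*} (G : SimpleGraph V) {s : Set V}
    {u : V} (hu : u ∈ s) (h : ∀ w ∈ s, w ≠ u → G.Adj u w) : (G.induce s).Connected := by
  rw [connected_iff_exists_forall_reachable]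
  refine ⟨⟨u, hu⟩, fun ⟨w, hw⟩ => ?_⟩
  by_cases hwu : w = u
  · subst hwu
    exact Reachable.refl _
  · exact Adj.reachable (G := G.induce s) (h w hw hwu)

/-- Adding a vertex with a neighbour in `s` to `s` preserves connectedness. -/
theorem SimpleGraph.induce_insert_connected {V : Type*} (G : SimpleGraph V) {s : Set V} {u v : V}
    (hs : (G.induce s).Connected) (hu : u ∈ s) (huv : G.Adj u v) :
    (G.induce (insert v s)).Connected := by
  rw [connected_iff_exists_forall_reachable]
  refine ⟨⟨u, Or.inr hu⟩, ?_⟩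
  rintro ⟨w, rfl | hw⟩
  · exact Adj.reachable (G := G.induce _) huv
  · exact (hs.preconnected ⟨u, hu⟩ ⟨w, hw⟩).map (G.induceHomOfLE (Set.subset_insert v s)).toHom

/-- if the branch set `G(f,a)` contains a universal vertex `u ≠ v` and `v`
has a neighbour in `G(f,b)`, then relabeling `v` from `a` to `b` yields an `H`-model. -/
theorem stmt8 {V W : Type} [Fintype V] [DecidableEq V] (G : SimpleGraph V)
    (H : SimpleGraph W) (f : V → W) (hf : IsModel G H f) (v : V) (a b : W)
    (hva : f v = a) (hba : b ≠ a)
    (huniv : ∃ u : V, u ≠ v ∧ f u = a ∧ ∀ w : V, w ≠ u → G.Adj u w)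
    (hnbr : ∃ u : V, G.Adj v u ∧ f u = b) :
    IsModel G H (Function.update f v b) := by
  obtain ⟨u, huv, hua, hu⟩ := huniv
  obtain ⟨x, hvx, hxb⟩ := hnbr
  have hg : ∀ w, f w ≠ a → Function.update f v b w = f w := fun w hw =>
    Function.update_of_ne (by rintro rfl; exact hw hva) _ _
  have hgu : Function.update f v b u = a := by rw [Function.update_of_ne huv, hua]
  have hadj : ∀ j, j ≠ a → ∃ y, G.Adj u y ∧ Function.update f v b y = j := by
    intro j hj
    obtain ⟨y, rfl⟩ := (hf.1 j).1
    exact ⟨y, hu y (fun h => hj (h ▸ hua)), hg y hj⟩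
  refine ⟨fun i => ?_, fun i j hij => ?_⟩
  · by_cases hia : i = a
    · subst hia
      exact ⟨⟨u, hgu⟩, G.induce_connected_of_forall_adj hgu fun w _ => hu w⟩
    · refine ⟨(hadj i hia).imp fun y hy => hy.2, ?_⟩
      by_cases hib : i = b
      · subst hib
        have hset : Function.update f v i ⁻¹' {i} = insert v (f ⁻¹' {i}) := by
          ext w
          by_cases hw : w = v <;> simp [hw]
        rw [hset]
        exact G.induce_insert_connected (hf.1 i).2 hxb hvx.symm
      · have hset : Function.update f v b ⁻¹' {i} = f ⁻¹' {i} := by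
          ext w
          by_cases hw : w = v
          · simp [hw, hva, Ne.symm hia, Ne.symm hib]
          · simp [hw]
        rw [hset]
        exact (hf.1 i).2
  · by_cases hia : i = a
    · obtain ⟨y, hy, hyj⟩ := hadj j (hia ▸ hij.ne.symm)
      exact ⟨u, y, hy, hgu.trans hia.symm, hyj⟩
    by_cases hja : j = a
    · obtain ⟨y, hy, hyi⟩ := hadj i hia
      exact ⟨y, u, hy.symm, hyi, hgu.trans hja.symm⟩
    obtain ⟨y, z, hyz, rfl, rfl⟩ := hf.2 hij
    exact ⟨y, z, hyz, hg y hia, hg z hja⟩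
end

section
/- Given a k-connected graph G and a K_k-model f of G such that some branch set B has weak connections to all other branch sets, it is impossible to designate lynchpins for these weak connections so that B contains a vertex that is not a lynchpin of any of the weak connections and some other branch set also contains a vertex that is not a lynchpin of any of the weak connections. -/
open SimpleGraph

/-- A lynchpin of the weak connection between two branch sets covers every connecting edge
between them. -/
theorem IsLynchpin.eq_or_eq {V W : Type*} {G : SimpleGraph V} {H : SimpleGraph W} {f : V → W}
    {a b : W} {p u w : V} (hp : IsLynchpin G H f a b p) (huw : G.Adj u w) (hu : f u = a)
    (hw : f w = b) : u = p ∨ w = p := by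
  rcases hp with ⟨u', v', ⟨-, -, -, huniq⟩, hp⟩ | ⟨-, ⟨hpa, -, h⟩ | ⟨hpb, -, h⟩⟩
  · obtain ⟨rfl, rfl⟩ := huniq u w huw hu hw
    exact hp.imp Eq.symm Eq.symm
  · exact .inl (h u w huw (hu.trans hpa.symm) hw)
  · exact .inr (h w u huw.symm (hw.trans hpb.symm) hu)

/-- If no edge of `G` leaves `A`, then every vertex reachable from `A` lies in `A`. -/
theorem SimpleGraph.Reachable.mem_of_adj_closed {V : Type*} {G : SimpleGraph V} {A : Set V}
    (hA : ∀ u w : V, G.Adj u w → u ∈ A → w ∈ A) {u w : V} (h : G.Reachable u w)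
    (hu : u ∈ A) : w ∈ A := by
  obtain ⟨q⟩ := h
  induction q with
  | nil => exact hu
  | cons hadj _ ih => exact ih (hA _ _ hadj hu)

/-- for a `k`-connected `G` and a `K_k`-model `f` whose branch set with
label `ℓ` has weak connections to all other branch sets, it is impossible to designate
lynchpins so that both the branch set of `ℓ` and some other branch set contain a vertex
that is not a lynchpin of any of these weak connections. -/
theorem stmt11 {V : Type} [Fintype V] (k : ℕ) (G : SimpleGraph V)
    (hk : KConnected G k) (f : V → Fin k)
    (hf : IsModel G (⊤ : SimpleGraph (Fin k)) f) (l : Fin k)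
    (hweak : ∀ b : Fin k, b ≠ l → WeaklyConnected G (⊤ : SimpleGraph (Fin k)) f l b) :
    ¬ ∃ p : Fin k → V,
        (∀ b : Fin k, b ≠ l → IsLynchpin G (⊤ : SimpleGraph (Fin k)) f l b (p b)) ∧
        (∃ x : V, f x = l ∧ ∀ b : Fin k, b ≠ l → x ≠ p b) ∧
        (∃ y : V, f y ≠ l ∧ ∀ b : Fin k, b ≠ l → y ≠ p b) := by
  rintro ⟨p, hp, ⟨x, hxl, hx⟩, y, hyl, hy⟩
  have hcard : (p '' {l}ᶜ).ncard < k := by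
    refine (Set.ncard_image_le (Set.toFinite _)).trans_lt ?_
    have hlt := Set.ncard_lt_ncard
      (Set.ssubset_univ_iff.2 (by simp : ({l}ᶜ : Set (Fin k)) ≠ Set.univ))
    simpa [Set.ncard_univ] using hlt
  have hxS : x ∈ (p '' {l}ᶜ)ᶜ := by
    rintro ⟨b, hb, rfl⟩
    exact hx b hb rfl
  have hyS : y ∈ (p '' {l}ᶜ)ᶜ := by
    rintro ⟨b, hb, rfl⟩
    exact hy b hb rfl
  refine hk _ (Set.toFinite _) hcard ⟨⟨x, hxS⟩, ⟨y, hyS⟩, fun hreach => hyl ?_⟩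
  refine hreach.mem_of_adj_closed (A := {v : ↥(p '' {l}ᶜ)ᶜ | f v = l}) ?_ hxl
  intro u w huw hu
  by_contra hw
  rcases (hp (f w) hw).eq_or_eq huw hu rfl with h | h
  · exact u.2 ⟨f w, hw, h.symm⟩
  · exact w.2 ⟨f w, hw, h.symm⟩
end

section
/- Let G be a graph, f an H-model of G, and suppose there exist labels a, b and a vertex v such that |G(f,a)| ≥ 2, v lies in a leaf block L of the block tree of G(f,a), and relabeling v to b (changing no other vertex) yields another H-model g. Then v has a neighbour in G(g,a); and moreover if L has at least two vertices besides v, then v has a neighbour u in G(g,a) such that u ∈ V(L) and u is an interior vertex in a leaf block of the block tree of G(g,a). -/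
open SimpleGraph

namespace SimpleGraph

variable {V : Type*} {G : SimpleGraph V}

/-- `T` is a union of components of the subgraph of `G` induced on `S`. -/
def ClosedIn (G : SimpleGraph V) (S T : Set V) : Prop :=
  T ⊆ S ∧ ∀ p ∈ T, ∀ q ∈ S, G.Adj p q → q ∈ T

/-- The subgraph of `G` induced on `S` has no proper nonempty union of components. -/
def Indecomposable (G : SimpleGraph V) (S : Set V) : Prop :=
  ∀ T : Set V, ClosedIn G S T → T.Nonempty → S ⊆ T

theorem ClosedIn.sdiff {S T : Set V} (h : ClosedIn G S T) : ClosedIn G S (S \ T) :=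
  ⟨Set.sdiff_subset, fun p hp q hq hpq => ⟨hq, fun hqT => hp.2 (h.2 q hqT p hp.1 hpq.symm)⟩⟩

theorem preconnected_induce_iff_indecomposable {S : Set V} :
    (G.induce S).Preconnected ↔ Indecomposable G S := by
  constructor
  · rintro h T ⟨hTS, hT⟩ ⟨t, ht⟩ s hs
    obtain ⟨p⟩ := h ⟨t, hTS ht⟩ ⟨s, hs⟩
    have key : ∀ (x y : S), (G.induce S).Walk x y → x.1 ∈ T → y.1 ∈ T := by
      intro x y p
      induction p with
      | nil => exact id
      | cons hadj _ ih => exact fun hx => ih (hT _ hx _ (Subtype.prop _) hadj)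
    exact key _ _ p ht
  · intro h x y
    have hsub := h {z | ∃ hz : z ∈ S, (G.induce S).Reachable x ⟨z, hz⟩}
      ⟨fun z hz => hz.1, fun p ⟨hp, hxp⟩ q hq hpq =>
        ⟨hq, hxp.trans (Adj.reachable (G := G.induce S) (u := ⟨p, hp⟩) (v := ⟨q, hq⟩) hpq)⟩⟩
      ⟨x.1, x.2, Reachable.refl _⟩
    exact (hsub y.2).2

theorem isCutVertexOf_iff {A : Set V} {v : V} :
    IsCutVertexOf G A v ↔ v ∈ A ∧ ¬ Indecomposable G (A \ {v}) := by
  rw [← preconnected_induce_iff_indecomposable]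
  simp only [IsCutVertexOf, Preconnected, not_forall]

theorem connected_induce_iff_indecomposable {S : Set V} :
    (G.induce S).Connected ↔ Indecomposable G S ∧ S.Nonempty := by
  rw [connected_iff, preconnected_induce_iff_indecomposable, Set.nonempty_coe_sort]

theorem _root_.NoCutVertexIn.indecomposable_sdiff {B : Set V} (hB : NoCutVertexIn G B) {y : V}
    (hy : y ∈ B) : Indecomposable G (B \ {y}) := by
  by_contra h
  exact hB y (isCutVertexOf_iff.2 ⟨hy, h⟩)

theorem exists_closedIn_notMem {S : Set V} (h : ¬ Indecomposable G S) (x : V) :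
    ∃ T, ClosedIn G S T ∧ T.Nonempty ∧ x ∉ T := by
  unfold Indecomposable at h
  push Not at h
  obtain ⟨T, hT, hne, hST⟩ := h
  by_cases hx : x ∈ T
  · exact ⟨S \ T, hT.sdiff, Set.sdiff_nonempty.2 hST, fun h => h.2 hx⟩
  · exact ⟨T, hT, hne, hx⟩

/-- A part of an indecomposable set attached to the rest only through `x` is indecomposable. -/
theorem Indecomposable.of_attached {S R : Set V} {x : V} (hS : Indecomposable G S) (hxR : x ∈ R)
    (hRS : R ⊆ S) (h : ∀ p ∈ R, p ≠ x → ∀ q ∈ S, G.Adj p q → q ∈ R) : Indecomposable G R := by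
  by_contra hR
  obtain ⟨T, hT, hne, hxT⟩ := exists_closedIn_notMem hR x
  refine hxT (hS T ⟨hT.1.trans hRS, fun p hp q hq hpq => ?_⟩ hne (hRS hxR))
  exact hT.2 p hp q (h p (hT.1 hp) (fun e => hxT (e ▸ hp)) q hq hpq) hpq

theorem Indecomposable.of_sdiff_singleton {D : Set V} {z w : V} (hD : Indecomposable G (D \ {z}))
    (hw : w ∈ D) (hz : z ∈ D) (hzw : G.Adj z w) : Indecomposable G D := by
  by_contra h
  obtain ⟨T, hT, hne, hzT⟩ := exists_closedIn_notMem h z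
  have hsub := hD T ⟨fun p hp => ⟨hT.1 hp, fun e => hzT (e ▸ hp)⟩,
    fun p hp q hq hpq => hT.2 p hp q hq.1 hpq⟩ hne
  exact hzT (hT.2 w (hsub ⟨hw, hzw.ne'⟩) z hz hzw.symm)

theorem exists_adj_of_indecomposable {S : Set V} (hS : Indecomposable G S) {v w : V} (hv : v ∈ S)
    (hw : w ∈ S) (hne : w ≠ v) : ∃ u ∈ S, G.Adj v u := by
  by_contra! h
  exact hne (hS {v} ⟨by simpa using hv, by rintro p rfl q hq hpq; exact absurd hpq (h q hq)⟩
    ⟨v, rfl⟩ hw)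

/-- All neighbours of an interior vertex of a block lie in that block. -/
theorem _root_.IsBlockOf.adj_mem [Finite V] {A L : Set V} (hL : IsBlockOf G A L) {z w : V} (hz : z ∈ L)
    (hcut : ¬ IsCutVertexOf G A z) (hw : w ∈ A) (hzw : G.Adj z w) : w ∈ L := by
  obtain ⟨hLA, -, hconn, hno, hmax⟩ := hL
  have hAz : Indecomposable G (A \ {z}) := by
    by_contra h
    exact hcut (isCutVertexOf_iff.2 ⟨hLA hz, h⟩)
  obtain ⟨D, ⟨hDA, hLD, hwD, hD⟩, hmin⟩ := (Set.toFinite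
    {D : Set V | D ⊆ A ∧ L ⊆ D ∧ w ∈ D ∧ Indecomposable G (D \ {z})}).exists_minimal
    ⟨A, subset_rfl, hLA, hw, hAz⟩
  have hDL : D = L := by
    refine hmax D hLD hDA (connected_induce_iff_indecomposable.2
      ⟨hD.of_sdiff_singleton hwD (hLD hz) hzw, ⟨z, hLD hz⟩⟩) fun y hy => ?_
    obtain ⟨hyD, hy⟩ := isCutVertexOf_iff.1 hy
    have hyz : y ≠ z := by
      rintro rfl
      exact hy hD
    obtain ⟨T, hT, hne, hzT⟩ := exists_closedIn_notMem hy z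
    have hyT : y ∉ T := fun h => (hT.1 h).2 rfl
    have hLy : Indecomposable G (L \ {y}) := by
      by_cases hyL : y ∈ L
      · exact hno.indecomposable_sdiff hyL
      · rw [Set.sdiff_singleton_eq_self hyL]
        exact (connected_induce_iff_indecomposable.1 hconn).1
    have hTL : ∀ t ∈ T, t ∉ L := by
      intro t ht htL
      refine hzT (hLy (T ∩ L) ⟨fun p hp => ⟨hp.2, fun e => hyT (e ▸ hp.1)⟩,
        fun p hp q hq hpq => ⟨hT.2 p hp.1 q ⟨hLD hq.1, hq.2⟩ hpq, hq.1⟩⟩ ⟨t, ht, htL⟩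
        ⟨hz, hyz.symm⟩).1
    have hwT : w ∉ T := fun h => hzT (hT.2 w h z ⟨hLD hz, hyz.symm⟩ hzw.symm)
    have hDT : Indecomposable G ((D \ T) \ {z}) := by
      refine hD.of_attached (x := y) ⟨⟨hyD, hyT⟩, hyz⟩ (fun p hp => ⟨hp.1.1, hp.2⟩) ?_
      exact fun p hp hpy q hq hpq =>
        ⟨⟨hq.1, fun hqT => hp.1.2 (hT.2 q hqT p ⟨hp.1.1, hpy⟩ hpq.symm)⟩, hq.2⟩
    obtain ⟨t, ht⟩ := hne
    exact (hmin (y := D \ T) ⟨Set.sdiff_subset.trans hDA,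
      fun l hl => ⟨hLD hl, fun h => hTL l h hl⟩, ⟨hwD, hwT⟩, hDT⟩ Set.sdiff_subset
      (hT.1 ht).1).2 ht
  exact hDL ▸ hwD

/-- A connected piece `C` of `B`, attached to the rest of `B` only through `x` and containing no
cut vertex of `B`, forms a leaf block together with `x`. -/
theorem isLeafBlockOf_insert {B C : Set V} {x : V} (hB : Indecomposable G B) (hxB : x ∈ B)
    (hC : ClosedIn G (B \ {x}) C) (hCne : C.Nonempty) (hCind : Indecomposable G C)
    (hcut : ∀ y ∈ C, ¬ IsCutVertexOf G B y) : IsLeafBlockOf G B (insert x C) := by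
  have hxC : x ∉ C := fun h => (hC.1 h).2 rfl
  have hMB : insert x C ⊆ B := Set.insert_subset hxB fun p hp => (hC.1 hp).1
  have hatt : ∀ p ∈ insert x C, p ≠ x → ∀ q ∈ B, G.Adj p q → q ∈ insert x C := by
    intro p hp hpx q hq hpq
    by_cases hqx : q = x
    · exact Or.inl hqx
    · exact Or.inr (hC.2 p (hp.resolve_left hpx) q ⟨hq, hqx⟩ hpq)
  refine ⟨⟨hMB, ⟨x, Or.inl rfl⟩, connected_induce_iff_indecomposable.2
    ⟨hB.of_attached (Or.inl rfl) hMB hatt, ⟨x, Or.inl rfl⟩⟩, fun y hy => ?_, ?_⟩, ?_⟩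
  · obtain ⟨hyM, hy⟩ := isCutVertexOf_iff.1 hy
    obtain rfl | hyC := hyM
    · rw [Set.insert_sdiff_self_of_notMem hxC] at hy
      exact hy hCind
    · refine hcut y hyC (isCutVertexOf_iff.2 ⟨hMB (Or.inr hyC), fun h => hy ?_⟩)
      refine h.of_attached (x := x) ⟨Or.inl rfl, fun e => hxC (e ▸ hyC)⟩
        (Set.sdiff_subset_sdiff_left hMB) ?_
      exact fun p hp hpx q hq hpq => ⟨hatt p hp.1 hpx q hq.1 hpq, hq.2⟩
  · intro B' hMB' hB'B _ hno
    refine subset_antisymm (fun p hp => ?_) hMB'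
    by_cases hpx : p = x
    · exact Or.inl hpx
    · refine Or.inr (hno.indecomposable_sdiff (hMB' (Or.inl rfl)) C ⟨?_, ?_⟩ hCne ⟨hp, hpx⟩)
      · exact fun q hq => ⟨hMB' (Or.inr hq), (hC.1 hq).2⟩
      · exact fun p hp q hq hpq => hC.2 p hp q ⟨hB'B hq.1, hq.2⟩ hpq
  · have heq : ∀ y ∈ insert x C, IsCutVertexOf G B y → y = x :=
      fun y hy hyc => hy.resolve_right fun h => hcut y h hyc
    exact fun y y' hy hy' h h' => (heq y hy h).trans (heq y' hy' h').symm

theorem _root_.IsLeafBlockOf.exists_adj_interior [Finite V] {A L : Set V} (hL : IsLeafBlockOf G A L)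
    {v : V} (hvL : v ∈ L) (hB : Indecomposable G (A \ {v})) (hcard : 2 ≤ (L \ {v}).ncard) :
    ∃ u ∈ L, G.Adj v u ∧ ∃ L', IsLeafBlockOf G (A \ {v}) L' ∧ u ∈ L' ∧
      ¬ IsCutVertexOf G (A \ {v}) u := by
  obtain ⟨hblock, huniq⟩ := hL
  have hLA := hblock.1
  have hvcut : ¬ IsCutVertexOf G A v := fun h => (isCutVertexOf_iff.1 h).2 hB
  obtain ⟨p₁, p₂, hp₁, hp₂, hp⟩ := (Set.one_lt_ncard_iff (Set.toFinite _)).1 hcard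
  obtain ⟨r, hrL, hrv, hr⟩ : ∃ r ∈ L, r ≠ v ∧ ∀ y ∈ L, IsCutVertexOf G A y → y = r := by
    by_cases h : ∃ r ∈ L, IsCutVertexOf G A r
    · obtain ⟨r, hrL, hr⟩ := h
      exact ⟨r, hrL, fun e => hvcut (e ▸ hr), fun y hy hyc => huniq y r hy hrL hyc hr⟩
    · exact ⟨p₁, hp₁.1, hp₁.2, fun y hy hyc => absurd ⟨y, hy, hyc⟩ h⟩
  obtain ⟨u₀, hu₀, hvu₀⟩ : ∃ u ∈ L \ {r}, G.Adj v u := by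
    obtain ⟨s, hs, hsr⟩ : ∃ s ∈ L \ {v}, s ≠ r := by
      by_cases h : p₁ = r
      · exact ⟨p₂, hp₂, fun e => hp (h.trans e.symm)⟩
      · exact ⟨p₁, hp₁, h⟩
    exact exists_adj_of_indecomposable (hblock.2.2.2.1.indecomposable_sdiff hrL)
      ⟨hvL, hrv.symm⟩ ⟨hs.1, hsr⟩ hs.2
  obtain ⟨C, ⟨x, hxB, hC, hrC, u, huC, hvu⟩, hmin⟩ := (Set.toFinite
    {C : Set V | ∃ x ∈ A \ {v}, ClosedIn G ((A \ {v}) \ {x}) C ∧ r ∉ C ∧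
      ∃ u ∈ C, G.Adj v u}).exists_minimal
    ⟨(A \ {v}) \ {r}, r, ⟨hLA hrL, hrv⟩, ⟨subset_rfl, fun _ _ _ hq _ => hq⟩,
      fun h => h.2 rfl, u₀, ⟨⟨hLA hu₀.1, hvu₀.ne'⟩, hu₀.2⟩, hvu₀⟩
  have hxC : x ∉ C := fun h => (hC.1 h).2 rfl
  have hCind : Indecomposable G C := by
    by_contra h
    obtain ⟨T, hT, ⟨t, ht⟩, huT⟩ := exists_closedIn_notMem h u
    refine (hmin (y := C \ T) ⟨x, hxB, ⟨hT.sdiff.1.trans hC.1, fun p hp q hq hpq => ?_⟩,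
      fun h => hrC h.1, u, ⟨huC, huT⟩, hvu⟩ Set.sdiff_subset (hT.1 ht)).2 ht
    exact hT.sdiff.2 p hp q (hC.2 p hp.1 q hq hpq) hpq
  have hCL : C ⊆ L := by
    have hsub := hCind (C ∩ L) ⟨Set.inter_subset_left, fun p hp q hq hpq =>
      ⟨hq, hblock.adj_mem hp.2 (fun h => hrC (hr p hp.2 h ▸ hp.1)) (hC.1 hq).1.1 hpq⟩⟩
      ⟨u, huC, hblock.adj_mem hvL hvcut (hC.1 huC).1.1 hvu⟩
    exact fun p hp => (hsub hp).2
  have hcut : ∀ y ∈ C, ¬ IsCutVertexOf G (A \ {v}) y := by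
    intro y hyC hy
    obtain ⟨hyB, hy⟩ := isCutVertexOf_iff.1 hy
    obtain ⟨T, hT, ⟨t, ht⟩, hxT⟩ := exists_closedIn_notMem hy x
    have hyT : y ∉ T := fun h => (hT.1 h).2 rfl
    have hTC : T ⊆ C := by
      intro p hpT
      by_contra hpC
      refine hyT (hB (T \ C) ⟨fun q hq => (hT.1 hq.1).1, fun q hq s hs hqs => ?_⟩
        ⟨p, hpT, hpC⟩ hyB).1
      have hsC : s ∉ C := fun h =>
        hq.2 (hC.2 s h q ⟨(hT.1 hq.1).1, fun e => hxT (e ▸ hq.1)⟩ hqs.symm)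
      exact ⟨hT.2 q hq.1 s ⟨hs, fun e => hsC (e ▸ hyC)⟩ hqs, hsC⟩
    by_cases hadj : ∃ u ∈ T, G.Adj v u
    · exact hyT (hmin (y := T) ⟨y, hyB, hT, fun h => hrC (hTC h), hadj⟩ hTC hyC)
    · refine hrC (hr y (hCL hyC) (isCutVertexOf_iff.2 ⟨hyB.1, fun h => ?_⟩) ▸ hyC)
      have hvT := h T ⟨fun q hq => ⟨(hT.1 hq).1.1, (hT.1 hq).2⟩, fun p hp q hq hpq =>
        hT.2 p hp q ⟨⟨hq.1, fun e => hadj ⟨p, hp, (e ▸ hpq).symm⟩⟩, hq.2⟩ hpq⟩ ⟨t, ht⟩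
        ⟨hLA hvL, fun e => hyB.2 e.symm⟩
      exact (hT.1 hvT).1.2 rfl
  exact ⟨u, hCL huC, hvu, insert x C,
    isLeafBlockOf_insert hB hxB hC ⟨u, huC⟩ hCind hcut, Or.inr huC, hcut u huC⟩

end SimpleGraph

/-- if `|G(f,a)| ≥ 2`, `v` lies in a leaf block `L` of `G(f,a)`, and
relabeling `v` to `b` yields another `H`-model `g`, then `v` has a neighbour in
`G(g,a)`; and if `L` has at least two vertices besides `v`, then `v` has a neighbour
`u ∈ L` in `G(g,a)` that is an interior vertex in a leaf block of `G(g,a)`. -/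
theorem stmt14 {V W : Type} [Fintype V] [DecidableEq V] (G : SimpleGraph V)
    (H : SimpleGraph W) (f : V → W) (hf : IsModel G H f) (a b : W) (v : V)
    (hva : f v = a) (hba : b ≠ a) (hcard : 2 ≤ (f ⁻¹' {a}).ncard)
    (L : Set V) (hL : IsLeafBlockOf G (f ⁻¹' {a}) L) (hvL : v ∈ L)
    (g : V → W) (hg : g = Function.update f v b) (hgm : IsModel G H g) :
    (∃ u : V, G.Adj v u ∧ g u = a) ∧
    (2 ≤ (L \ {v}).ncard →
      ∃ u : V, G.Adj v u ∧ g u = a ∧ u ∈ L ∧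
        ∃ L' : Set V, IsLeafBlockOf G (g ⁻¹' {a}) L' ∧ u ∈ L' ∧
          ¬ IsCutVertexOf G (g ⁻¹' {a}) u) := by
  have hA : g ⁻¹' {a} = f ⁻¹' {a} \ {v} := by
    ext u
    by_cases hu : u = v <;> simp [hg, hu, hba]
  have hgA : ∀ u, g u = a ↔ u ∈ f ⁻¹' {a} \ {v} := fun u => by rw [← hA]; rfl
  refine ⟨?_, fun hLv => ?_⟩
  · obtain ⟨w, hw, hwv⟩ := Set.exists_ne_of_one_lt_ncard hcard v
    obtain ⟨u, hu, hvu⟩ := exists_adj_of_indecomposable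
      (connected_induce_iff_indecomposable.1 (hf.1 a).2).1 hva hw hwv
    exact ⟨u, hvu, (hgA u).2 ⟨hu, hvu.ne'⟩⟩
  · have hB := (connected_induce_iff_indecomposable.1 (hgm.1 a).2).1
    rw [hA] at hB ⊢
    obtain ⟨u, huL, hvu, h⟩ := IsLeafBlockOf.exists_adj_interior hL hvL hB hLv
    exact ⟨u, hvu, (hgA u).2 ⟨hL.1.1 huL, hvu.ne'⟩, huL, h⟩
end
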